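/- Let n ≥ 5 be an integer, K₀ = [π² n(n-4)(n²-4)]^{-1} (Γ(n)/Γ(n/2))^{4/n}, C > 0, and let G(λ) = (2^{4-n} π^{(n+1)/2} / ((n-4) Γ((n-1)/2))) λ^{(4-n)/2} and G₀(λ) = (K₀/C)^{n/4} (G(λ) - λ G'(λ)) for λ > 0. Then for every λ > 0: (-G₀'(λ)/(λ(n-2)(n-1)))^{(n-4)/n} = C(n-4)² (4 G₀(λ) - ((n-2)/(n-1)) λ G₀'(λ)). -/

import Mathlib

theorem aux_const (N : ℝ) (hN : 5 ≤ N) :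
    2 ^ ((4 : ℝ) - N) * Real.pi ^ ((N + 1) / 2) / ((N - 4) * Real.Gamma ((N - 1) / 2))
      = 4 * (N - 1) / (N - 4) * (Real.pi ^ (N / 2) * (Real.Gamma N / Real.Gamma (N / 2))⁻¹) := by
  have hd := Real.Gamma_mul_Gamma_add_half (N / 2)
  have h1 : Real.Gamma (N / 2 + 1 / 2) = (N - 1) / 2 * Real.Gamma ((N - 1) / 2) := by
    rw [← Real.Gamma_add_one (by linarith)]
    congr 1; ring
  rw [h1, show 2 * (N / 2) = N by ring] at hd
  have g1 : 0 < Real.Gamma ((N - 1) / 2) := Real.Gamma_pos_of_pos (by linarith)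
  have g2 : 0 < Real.Gamma (N / 2) := Real.Gamma_pos_of_pos (by linarith)
  have g3 : 0 < Real.Gamma N := Real.Gamma_pos_of_pos (by linarith)
  have e1 : (2 : ℝ) ^ ((4 : ℝ) - N) = 8 * 2 ^ (1 - N) := by
    rw [show (4 : ℝ) - N = 3 + (1 - N) by ring, Real.rpow_add (by norm_num)]
    norm_num
  have e2 : Real.pi ^ ((N + 1) / 2) = Real.pi ^ (N / 2) * √Real.pi := by
    rw [Real.sqrt_eq_rpow, ← Real.rpow_add Real.pi_pos]
    congr 1; ring
  rw [e1, e2]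
  have h4 : N - 4 ≠ 0 := by linarith
  field_simp
  linear_combination (-8) * hd

theorem aux_pow (N C K P R : ℝ) (hN : 5 ≤ N) (hC : 0 < C) (hR : 0 < R)
    (hP : P = N * (N - 4) * (N ^ 2 - 4))
    (hK : K = (Real.pi ^ 2 * N * (N - 4) * (N ^ 2 - 4))⁻¹ * R ^ (4 / N)) :
    ((K / C) ^ (N / 4) * (Real.pi ^ (N / 2) * R⁻¹)) ^ ((N - 4) / N)
      = C * P * ((K / C) ^ (N / 4) * (Real.pi ^ (N / 2) * R⁻¹)) := by
  have hPp : 0 < P := by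
    rw [hP]
    have : 0 < N ^ 2 - 4 := by nlinarith
    have : 0 < N - 4 := by linarith
    positivity
  have hpi := Real.pi_pos
  have hN0 : N ≠ 0 := by linarith
  have hK' : K = (Real.pi ^ 2 * P)⁻¹ * R ^ (4 / N) := by rw [hK, hP]; ring_nf
  have hKp : 0 < K := by rw [hK']; positivity
  have hB : (K / C) ^ (N / 4) * (Real.pi ^ (N / 2) * R⁻¹) = (C * P) ^ (-(N / 4)) := by
    have e1 : K / C = (C * P)⁻¹ * ((Real.pi ^ 2)⁻¹ * R ^ (4 / N)) := by
      rw [hK']; field_simp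
    have e2 : ((Real.pi ^ 2)⁻¹ * R ^ (4 / N)) ^ (N / 4) = (Real.pi ^ (N / 2))⁻¹ * R := by
      rw [Real.mul_rpow (by positivity) (by positivity), ← Real.rpow_mul hR.le,
        Real.inv_rpow (by positivity), ← Real.rpow_natCast, ← Real.rpow_mul hpi.le,
        show 4 / N * (N / 4) = 1 by field_simp, Real.rpow_one]
      congr 3; push_cast; ring
    rw [e1, Real.mul_rpow (by positivity) (by positivity), e2, Real.inv_rpow (by positivity),
      Real.rpow_neg (by positivity)]
    have : 0 < Real.pi ^ (N / 2) := by positivity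
    field_simp
  rw [hB, ← Real.rpow_mul (by positivity)]
  have hCP : 0 < C * P := by positivity
  conv_rhs => rw [← Real.rpow_one_add' hCP.le (by linarith)]
  congr 1
  field_simp
  ring

/-- The explicit Euclidean quantity
`G(λ) = (2^{4-n} π^{(n+1)/2}/((n-4)Γ((n-1)/2))) λ^{(4-n)/2}` and
`G₀(λ) = (K₀/C)^{n/4}(G(λ) - λG'(λ))` satisfy, for every `λ > 0`, the ODE
`(-G₀'(λ)/(λ(n-2)(n-1)))^{(n-4)/n} = C(n-4)²(4G₀(λ) - ((n-2)/(n-1))λG₀'(λ))`,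
where `K₀ = [π² n(n-4)(n²-4)]⁻¹ (Γ(n)/Γ(n/2))^{4/n}` and `C > 0`. -/
theorem stmt_8 (n : ℕ) (hn : 5 ≤ n) (C : ℝ) (hC : 0 < C) :
    let K₀ : ℝ := (Real.pi ^ 2 * (n : ℝ) * ((n : ℝ) - 4) * ((n : ℝ) ^ 2 - 4))⁻¹ *
      (Real.Gamma (n : ℝ) / Real.Gamma ((n : ℝ) / 2)) ^ ((4 : ℝ) / (n : ℝ))
    let G : ℝ → ℝ := fun lam =>
      (2 ^ ((4 : ℝ) - n) * Real.pi ^ (((n : ℝ) + 1) / 2) /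
        (((n : ℝ) - 4) * Real.Gamma (((n : ℝ) - 1) / 2))) * lam ^ (((4 : ℝ) - n) / 2)
    let G₀ : ℝ → ℝ := fun lam => (K₀ / C) ^ ((n : ℝ) / 4) * (G lam - lam * deriv G lam)
    ∀ lam > (0 : ℝ),
      (-(deriv G₀ lam) / (lam * ((n : ℝ) - 2) * ((n : ℝ) - 1))) ^ (((n : ℝ) - 4) / (n : ℝ)) =
        C * ((n : ℝ) - 4) ^ 2 *
          (4 * G₀ lam - (((n : ℝ) - 2) / ((n : ℝ) - 1)) * lam * deriv G₀ lam) := by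
  intro K₀ G G₀ lam hlam
  have hN : (5 : ℝ) ≤ n := by exact_mod_cast hn
  have hGd : G = fun lam => (2 ^ ((4 : ℝ) - n) * Real.pi ^ (((n : ℝ) + 1) / 2) /
        (((n : ℝ) - 4) * Real.Gamma (((n : ℝ) - 1) / 2))) * lam ^ (((4 : ℝ) - n) / 2) := rfl
  have hG0d : G₀ = fun lam => (K₀ / C) ^ ((n : ℝ) / 4) * (G lam - lam * deriv G lam) := rfl
  have hK : K₀ = (Real.pi ^ 2 * (n : ℝ) * ((n : ℝ) - 4) * ((n : ℝ) ^ 2 - 4))⁻¹ *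
      (Real.Gamma (n : ℝ) / Real.Gamma ((n : ℝ) / 2)) ^ ((4 : ℝ) / (n : ℝ)) := rfl
  clear_value G₀ G K₀
  rw [aux_const n hN] at hGd
  have hR : 0 < Real.Gamma (n : ℝ) / Real.Gamma ((n : ℝ) / 2) :=
    div_pos (Real.Gamma_pos_of_pos (by linarith)) (Real.Gamma_pos_of_pos (by linarith))
  have key := aux_pow n C K₀ _ _ hN hC hR rfl hK
  generalize (n : ℝ) = N at *
  generalize Real.Gamma N / Real.Gamma (N / 2) = R at *
  have hKp : 0 < K₀ := by
    rw [hK]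
    have : 0 < N ^ 2 - 4 := by nlinarith
    have : 0 < N - 4 := by linarith
    positivity
  have hBp : 0 < (K₀ / C) ^ (N / 4) * (Real.pi ^ (N / 2) * R⁻¹) := by positivity
  clear hK
  generalize (K₀ / C) ^ (N / 4) = M at *
  generalize Real.pi ^ (N / 2) * R⁻¹ = A at *
  have h4 : N - 4 ≠ 0 := by linarith
  have h1 : N - 1 ≠ 0 := by linarith
  have h2 : N - 2 ≠ 0 := by linarith
  have hN0 : N ≠ 0 := by linarith
  have hd : ∀ x > (0 : ℝ), HasDerivAt (fun x : ℝ => x ^ ((4 - N) / 2))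
      ((4 - N) / 2 * x ^ ((4 - N) / 2) / x) x := by
    intro x hx
    have := Real.hasDerivAt_rpow_const (x := x) (p := (4 - N) / 2) (Or.inl hx.ne')
    rwa [Real.rpow_sub_one hx.ne', ← mul_div_assoc] at this
  have hG0 : ∀ x > (0 : ℝ), G₀ x = (M * A) * (2 * (N - 1) * (N - 2) / (N - 4)) * x ^ ((4 - N) / 2) := by
    intro x hx
    have hGx : deriv G x = 4 * (N - 1) / (N - 4) * A * ((4 - N) / 2 * x ^ ((4 - N) / 2) / x) := by
      rw [hGd]; exact ((hd x hx).const_mul _).deriv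
    rw [hG0d]
    simp only
    rw [hGx, hGd]
    field_simp
    ring
  have hG0' : deriv G₀ lam = (M * A) * (2 * (N - 1) * (N - 2) / (N - 4)) *
      ((4 - N) / 2 * lam ^ ((4 - N) / 2) / lam) := by
    have : G₀ =ᶠ[nhds lam] fun x => (M * A) * (2 * (N - 1) * (N - 2) / (N - 4)) * x ^ ((4 - N) / 2) := by
      filter_upwards [lt_mem_nhds hlam] with x hx using hG0 x hx
    rw [this.deriv_eq]
    exact ((hd lam hlam).const_mul _).deriv
  have hl : (lam ^ ((4 - N) / 2) / lam ^ (2 : ℝ)) ^ ((N - 4) / N) = lam ^ ((4 - N) / 2) := by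
    rw [← Real.rpow_sub hlam, ← Real.rpow_mul hlam.le]
    congr 1; field_simp; ring
  have hbase : -(deriv G₀ lam) / (lam * (N - 2) * (N - 1)) =
      (M * A) * (lam ^ ((4 - N) / 2) / lam ^ (2 : ℝ)) := by
    rw [hG0', Real.rpow_two]
    field_simp
    ring
  rw [hbase, Real.mul_rpow hBp.le (by positivity), hl, key, hG0', hG0 lam hlam]
  field_simp
  ring
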